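/- Let W = (ω₁,…,ω_r) be a C(x)-basis of A and α ∈ C̄. Let f = (1/u)·aW and g = (1/v)·bW with a, b ∈ C[x]^r and nonzero u, v ∈ C[x] satisfying gcd(a₁,…,a_r,u) = 1 and gcd(b₁,…,b_r,v) = 1. Suppose f = Δg and disp_α(v) ≥ 0. Let e ∈ C[x] and M ∈ C[x]^{r×r} be such that SW = (1/e)·MW. If W is a local integral basis of A at Z := {η ∈ α+ℤ : η ≤ β} for some β ∈ α+ℤ, and β is the only possible root of e in α+ℤ, then disp_α((x−β)·u) ≥ 1; that is, u has a root in α+ℤ distinct from β. -/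

import Mathlib

set_option maxHeartbeats 1000000
set_option synthInstance.maxHeartbeats 200000

open Polynomial Filter

noncomputable section

namespace PRec

variable (C : Type*) [Field C] [CharZero C]

/-- The algebraic closure of the coefficient field. -/
abbrev Cbar := AlgebraicClosure C

/-- The field of formal Laurent series over the algebraic closure. -/
abbrev LS := LaurentSeries (Cbar C)

/-- The Laurent-series variable `q`. -/
def qv : LS C := HahnSeries.single 1 1

open Classical in
/-- The valuation `ν_q`, with `ν_q 0 = ⊤`, valued in the extended reals. -/
def nuq (a : LS C) : EReal := if a = 0 then ⊤ else (((a.order : ℤ) : ℝ) : EReal)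

/-- Evaluation of a rational function at the point `α + m + q`. -/
def evalAt (α : Cbar C) (m : ℤ) (p : RatFunc C) : LS C :=
  RatFunc.eval ((algebraMap (Cbar C) (LS C)).comp (algebraMap C (Cbar C)))
    (algebraMap (Cbar C) (LS C) α + (m : LS C) + qv C) p

/-- Shorthand for the canonical map `C[x] → C(x)`. -/
abbrev toRat : Polynomial C →+* RatFunc C := algebraMap (Polynomial C) (RatFunc C)

variable (ℓ : ℕ → Polynomial C) (r : ℕ)

/-- The solution space `Sol_α(L)` of `L = ℓ₀ + ℓ₁ S + ⋯ + ℓ_r S^r` at `α`,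
indexed so that `b n` stands for the value of the solution at `α + n`. -/
def SolSet (α : Cbar C) : Set (ℤ → LS C) :=
  {b | ∀ n : ℤ, ∑ i ∈ Finset.range (r + 1),
      evalAt C α n (toRat C (ℓ i)) * b (n + i) = 0}

/-- The action of an element `f = f₀ + f₁ S + ⋯ + f_{r-1} S^{r-1}` of
`A = C(x)[S]/⟨L⟩` (represented by its coefficient vector) on a sequence. -/
def elemApply (α : Cbar C) (f : Fin r → RatFunc C) (b : ℤ → LS C) : ℤ → LS C :=
  fun n => ∑ i : Fin r, evalAt C α n (f i) * b (n + (i : ℤ))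

/-- Truncated subtraction on extended reals with the convention `⊤ - ⊤ = ⊤`. -/
def esub (a b : EReal) : EReal := if b = ⊤ then ⊤ else a - b

/-- The value function `val_α` on `A`. -/
def valAt (α : Cbar C) (f : Fin r → RatFunc C) : EReal :=
  ⨅ b ∈ SolSet C ℓ r α,
    esub (nuq C (elemApply C r α f b 0))
      (Filter.liminf (fun n : ℕ => nuq C (b (-(n : ℤ)))) Filter.atTop)

/-- `f ∈ A` is (locally) integral at `α`. -/
def IntegralAt (α : Cbar C) (f : Fin r → RatFunc C) : Prop :=
  0 ≤ valAt C ℓ r α f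

/-- Membership in the local subring `C(x)_α` of rational functions having no pole at `α`. -/
def InLocalRing (α : Cbar C) (f : RatFunc C) : Prop :=
  ∃ p q : Polynomial C, (Polynomial.aeval α) q ≠ 0 ∧ f = toRat C p / toRat C q

/-- `W` is a `C(x)`-vector space basis of `A` (represented on coefficient vectors). -/
def IsVSBasis (W : Fin r → (Fin r → RatFunc C)) : Prop :=
  LinearIndependent (RatFunc C) W ∧
    Submodule.span (RatFunc C) (Set.range W) = (⊤ : Submodule (RatFunc C) (Fin r → RatFunc C))

/-- The `C(x)_α`-span of a tuple of elements of `A`. -/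
def localSpan (α : Cbar C) (W : Fin r → (Fin r → RatFunc C)) :
    Set (Fin r → RatFunc C) :=
  {f | ∃ c : Fin r → RatFunc C, (∀ i, InLocalRing C α (c i)) ∧ f = ∑ i, c i • W i}

/-- `W` is a local integral basis of `A` at `α`. -/
def IsLocalIntegralBasis (α : Cbar C) (W : Fin r → (Fin r → RatFunc C)) : Prop :=
  IsVSBasis C r W ∧ (∀ i, IntegralAt C ℓ r α (W i)) ∧
    ∀ f : Fin r → RatFunc C, IntegralAt C ℓ r α f → f ∈ localSpan C r α W

/-- The standard basis `1, S, …, S^{r-1}` of `A`. -/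
def stdBasis : Fin r → (Fin r → RatFunc C) :=
  fun i j => if j = i then 1 else 0

/-- The shift automorphism `p(x) ↦ p(x+c)` of the polynomial ring. -/
def polyShiftEquiv (c : C) : Polynomial C ≃+* Polynomial C where
  toFun p := p.comp (X + Polynomial.C c)
  invFun p := p.comp (X - Polynomial.C c)
  left_inv p := by
    show (p.comp (X + Polynomial.C c)).comp (X - Polynomial.C c) = p
    rw [Polynomial.comp_assoc]; simp
  right_inv p := by
    show (p.comp (X - Polynomial.C c)).comp (X + Polynomial.C c) = p
    rw [Polynomial.comp_assoc]; simp
  map_add' p q := by simp [Polynomial.add_comp]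
  map_mul' p q := by simp [Polynomial.mul_comp]

/-- The shift `σ^k`, `p(x) ↦ p(x+k)`, on polynomials, for `k : ℤ`. -/
def polyShift (k : ℤ) (p : Polynomial C) : Polynomial C := polyShiftEquiv C (k : C) p

/-- `σ` on polynomials. -/
def polyσ : Polynomial C ≃+* Polynomial C := polyShiftEquiv C 1

/-- The shift automorphism `σ : f(x) ↦ f(x+1)` of the rational function field. -/
def ratσ : RatFunc C →+* RatFunc C :=
  RatFunc.mapRingHom (polyσ C : Polynomial C →+* Polynomial C)
    (by
      intro p hp
      simp only [Submonoid.mem_comap]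
      refine mem_nonZeroDivisors_iff_ne_zero.mpr ?_
      have hp0 : p ≠ 0 := mem_nonZeroDivisors_iff_ne_zero.mp hp
      simpa using (map_ne_zero_iff _ (polyσ C).injective).mpr hp0)

variable [NeZero r]

/-- The index `r - 1` as an element of `Fin r`. -/
def lastIdx : Fin r := ⟨r - 1, Nat.sub_lt (Nat.pos_of_ne_zero (NeZero.ne r)) one_pos⟩

/-- The action of `S` on `A = C(x)[S]/⟨L⟩`, on coefficient vectors with respect to the
basis `1, S, …, S^{r-1}`, using `S^r = -(ℓ₀/ℓ_r) - ⋯ - (ℓ_{r-1}/ℓ_r) S^{r-1}`. -/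
def Smap (f : Fin r → RatFunc C) : Fin r → RatFunc C :=
  fun j =>
    (if (j : ℕ) = 0 then 0 else
      ratσ C (f ⟨(j : ℕ) - 1, lt_of_le_of_lt (Nat.sub_le _ _) j.isLt⟩))
      - ratσ C (f (lastIdx r)) * (toRat C (ℓ j) / toRat C (ℓ r))

/-- The difference operator `Δ = S - 1` on `A`. -/
def Dmap (f : Fin r → RatFunc C) : Fin r → RatFunc C :=
  Smap C ℓ r f - f

/-- `f ∈ A` is summable. -/
def IsSummable (f : Fin r → RatFunc C) : Prop :=
  ∃ g : Fin r → RatFunc C, f = Dmap C ℓ r g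

/-- `disp_α(p) ≥ k`: `p` has two roots in `α + ℤ` at distance `k`. -/
def DispGe (α : Cbar C) (p : Polynomial (Cbar C)) (k : ℕ) : Prop :=
  ∃ m : ℤ, Polynomial.eval (α + (m : Cbar C)) p = 0 ∧
    Polynomial.eval (α + (m : Cbar C) + (k : Cbar C)) p = 0

/-- The dispersion `disp_α(p)` as an extended natural number
(`0` by convention for the empty set, which is excluded by the hypotheses below). -/
def dispVal (α : Cbar C) (p : Polynomial (Cbar C)) : ℕ∞ :=
  sSup ((fun k : ℕ => (k : ℕ∞)) '' {k : ℕ | DispGe C α p k})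

/-- A polynomial is shift-free if it is coprime to each of its nontrivial shifts. -/
def ShiftFree {K : Type*} [Field K] [CharZero K] (p : Polynomial K) : Prop :=
  ∀ k : ℤ, k ≠ 0 → IsCoprime p (p.comp (X + Polynomial.C (k : K)))

set_option linter.unusedSectionVars false

section Evaluation

/-- The embedding of `C[x]` into power series sending `p` to `p(η + q)`. -/
def psEval (η : Cbar C) : Polynomial C →+* PowerSeries (Cbar C) :=
  Polynomial.coeToPowerSeries.ringHom.comp
    ((Polynomial.compRingHom (X + Polynomial.C η)).comp
      (Polynomial.mapRingHom (algebraMap C (Cbar C))))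

lemma psEval_injective (η : Cbar C) : Function.Injective (psEval C η) := by
  intro p p' h
  have h1 := Polynomial.coe_injective (Cbar C) h
  have h2 : ((p.map (algebraMap C (Cbar C))).comp (X + Polynomial.C η)).comp
        (X - Polynomial.C η)
      = ((p'.map (algebraMap C (Cbar C))).comp (X + Polynomial.C η)).comp
        (X - Polynomial.C η) := congrArg (fun s => s.comp (X - Polynomial.C η)) h1
  rw [Polynomial.comp_assoc, Polynomial.comp_assoc] at h2
  simp only [Polynomial.add_comp, Polynomial.X_comp, Polynomial.C_comp, sub_add_cancel,
    Polynomial.comp_X] at h2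
  exact Polynomial.map_injective _ (algebraMap C (Cbar C)).injective h2

lemma constantCoeff_psEval (η : Cbar C) (p : Polynomial C) :
    PowerSeries.constantCoeff (psEval C η p) = Polynomial.aeval η p := by
  rw [← PowerSeries.coeff_zero_eq_constantCoeff_apply]
  simp [psEval, Polynomial.coeff_zero_eq_eval_zero, Polynomial.eval_map_algebraMap]

lemma eval₂_eq_psEval (α : Cbar C) (m : ℤ) (p : Polynomial C) :
    p.eval₂ ((algebraMap (Cbar C) (LS C)).comp (algebraMap C (Cbar C)))
      (algebraMap (Cbar C) (LS C) α + (m : LS C) + qv C)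
      = HahnSeries.ofPowerSeries ℤ (Cbar C) (psEval C (α + (m : Cbar C)) p) := by
  have key : Polynomial.eval₂RingHom ((algebraMap (Cbar C) (LS C)).comp (algebraMap C (Cbar C)))
      (algebraMap (Cbar C) (LS C) α + (m : LS C) + qv C)
      = (HahnSeries.ofPowerSeries ℤ (Cbar C)).comp (psEval C (α + (m : Cbar C))) := by
    apply Polynomial.ringHom_ext
    · intro c
      simp [psEval, LaurentSeries.algebraMap_apply]
    · have hm : (((m : Polynomial (Cbar C)) : PowerSeries (Cbar C))) = m :=
        map_intCast (Polynomial.coeToPowerSeries.ringHom (R := Cbar C)) m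
      simp [psEval, LaurentSeries.algebraMap_apply, qv, hm]
      ring
  exact congrArg (fun φ => φ p) key

lemma eval₂_ne_zero (α : Cbar C) (m : ℤ) {p : Polynomial C} (hp : p ≠ 0) :
    p.eval₂ ((algebraMap (Cbar C) (LS C)).comp (algebraMap C (Cbar C)))
      (algebraMap (Cbar C) (LS C) α + (m : LS C) + qv C) ≠ 0 := by
  rw [eval₂_eq_psEval, Ne, map_eq_zero_iff _ HahnSeries.ofPowerSeries_injective,
    map_eq_zero_iff _ (psEval_injective C _)]
  exact hp

/-- Evaluation at `α + m + q` as a ring homomorphism. -/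
def evalHom (α : Cbar C) (m : ℤ) : RatFunc C →+* LS C where
  toFun := evalAt C α m
  map_zero' := RatFunc.eval_zero _ _
  map_one' := RatFunc.eval_one _ _
  map_add' x y := RatFunc.eval_add _ _ (eval₂_ne_zero C α m x.denom_ne_zero)
    (eval₂_ne_zero C α m y.denom_ne_zero)
  map_mul' x y := RatFunc.eval_mul _ _ (eval₂_ne_zero C α m x.denom_ne_zero)
    (eval₂_ne_zero C α m y.denom_ne_zero)

lemma evalHom_toRat (α : Cbar C) (m : ℤ) (p : Polynomial C) :
    evalHom C α m (toRat C p)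
      = HahnSeries.ofPowerSeries ℤ (Cbar C) (psEval C (α + (m : Cbar C)) p) := by
  rw [← eval₂_eq_psEval]
  exact RatFunc.eval_algebraMap (S := Polynomial C) _ _ p

lemma ratσ_toRat (p : Polynomial C) : ratσ C (toRat C p) = toRat C (polyσ C p) := by
  have h := RatFunc.map_apply_div (polyσ C : Polynomial C →+* Polynomial C)
    (by
      intro p hp
      simp only [Submonoid.mem_comap]
      refine mem_nonZeroDivisors_iff_ne_zero.mpr ?_
      have hp0 : p ≠ 0 := mem_nonZeroDivisors_iff_ne_zero.mp hp
      simpa using (map_ne_zero_iff _ (polyσ C).injective).mpr hp0) p 1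
  rw [map_one, map_one, map_one, div_one, div_one] at h
  exact h

lemma exists_toRat_div (f : RatFunc C) :
    ∃ p q : Polynomial C, q ≠ 0 ∧ f = toRat C p / toRat C q :=
  ⟨f.num, f.denom, f.denom_ne_zero, (RatFunc.num_div_denom f).symm⟩

lemma aeval_polyσ (η : Cbar C) (p : Polynomial C) :
    Polynomial.aeval η (polyσ C p) = Polynomial.aeval (η + 1) p := by
  show Polynomial.aeval η (p.comp (X + Polynomial.C 1)) = _
  simp [Polynomial.aeval_comp]

lemma psEval_polyσ (η : Cbar C) (p : Polynomial C) :
    psEval C η (polyσ C p) = psEval C (η + 1) p := by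
  show psEval C η (p.comp (X + Polynomial.C 1)) = _
  simp only [psEval, RingHom.comp_apply, Polynomial.coe_mapRingHom, Polynomial.map_comp,
    Polynomial.coe_compRingHom_apply, Polynomial.comp_assoc]
  congr 2
  simp [add_assoc]

lemma evalHom_ratσ (α α' : Cbar C) (m m' : ℤ)
    (h : α + (m : Cbar C) + 1 = α' + (m' : Cbar C)) (f : RatFunc C) :
    evalHom C α m (ratσ C f) = evalHom C α' m' f := by
  obtain ⟨p, q, -, rfl⟩ := exists_toRat_div C f
  simp only [map_div₀, ratσ_toRat, evalHom_toRat, psEval_polyσ, h]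

lemma evalHom_congr (α α' : Cbar C) (m m' : ℤ)
    (h : α + (m : Cbar C) = α' + (m' : Cbar C)) (f : RatFunc C) :
    evalHom C α m f = evalHom C α' m' f := by
  obtain ⟨p, q, -, rfl⟩ := exists_toRat_div C f
  simp only [map_div₀, evalHom_toRat, h]

end Evaluation

section LocalRing

/-- The local ring `C(x)_η` as a subring of `C(x)`. -/
def localSubring (η : Cbar C) : Subring (RatFunc C) where
  carrier := {f | InLocalRing C η f}
  zero_mem' := ⟨0, 1, by simp, by simp⟩
  one_mem' := ⟨1, 1, by simp, by simp⟩
  add_mem' := by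
    rintro _ _ ⟨p, q, hq, rfl⟩ ⟨p', q', hq', rfl⟩
    refine ⟨p * q' + q * p', q * q', by simp [hq, hq'], ?_⟩
    have h0 : toRat C q ≠ 0 := RatFunc.algebraMap_ne_zero (by rintro rfl; simp at hq)
    have h0' : toRat C q' ≠ 0 := RatFunc.algebraMap_ne_zero (by rintro rfl; simp at hq')
    rw [div_add_div _ _ h0 h0']
    simp
  mul_mem' := by
    rintro _ _ ⟨p, q, hq, rfl⟩ ⟨p', q', hq', rfl⟩
    exact ⟨p * p', q * q', by simp [hq, hq'], by rw [div_mul_div_comm]; simp⟩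
  neg_mem' := by
    rintro _ ⟨p, q, hq, rfl⟩
    exact ⟨-p, q, hq, by simp [neg_div]⟩

lemma mem_localSubring {η : Cbar C} {f : RatFunc C} :
    f ∈ localSubring C η ↔ InLocalRing C η f := Iff.rfl

lemma div_mem_localSubring {η : Cbar C} (p : Polynomial C) {q : Polynomial C}
    (hq : Polynomial.aeval η q ≠ 0) : toRat C p / toRat C q ∈ localSubring C η :=
  ⟨p, q, hq, rfl⟩

lemma ratσ_mem_localSubring {η : Cbar C} {f : RatFunc C} (hf : f ∈ localSubring C (η + 1)) :
    ratσ C f ∈ localSubring C η := by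
  obtain ⟨p, q, hq, rfl⟩ := hf
  rw [map_div₀, ratσ_toRat, ratσ_toRat]
  exact div_mem_localSubring C _ (by rwa [aeval_polyσ])

/-- A reduced fraction vector has a pole at each root of its denominator. -/
lemma exists_div_notMem_localSubring {ι : Type*} {η : Cbar C} {b : ι → Polynomial C}
    {v : Polynomial C} (hv : v ≠ 0)
    (hgcd : ∀ d : Polynomial C, d ∣ v → (∀ i, d ∣ b i) → IsUnit d)
    (hroot : Polynomial.aeval η v = 0) :
    ∃ i, toRat C (b i) / toRat C v ∉ localSubring C η := by
  by_contra! hcon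
  refine minpoly.not_isUnit C η (hgcd _ (minpoly.dvd C η hroot) fun i => minpoly.dvd C η ?_)
  obtain ⟨p, q, hq, hpq⟩ := hcon i
  have hv0 : toRat C v ≠ 0 := RatFunc.algebraMap_ne_zero hv
  have hq0 : toRat C q ≠ 0 := RatFunc.algebraMap_ne_zero (by rintro rfl; simp at hq)
  rw [div_eq_div_iff hv0 hq0, ← map_mul, ← map_mul] at hpq
  have h := congrArg (Polynomial.aeval η) (RatFunc.algebraMap_injective C hpq)
  rw [map_mul, map_mul, hroot, mul_zero] at h
  exact (mul_eq_zero.mp h).resolve_right hq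

/-- Elements of the local ring expand as power series. -/
lemma exists_evalHom_eq_ofPowerSeries {η : Cbar C} {f : RatFunc C}
    (hf : f ∈ localSubring C η) :
    ∃ s, evalHom C η 0 f = HahnSeries.ofPowerSeries ℤ (Cbar C) s := by
  obtain ⟨p, q, hq, rfl⟩ := hf
  refine ⟨psEval C η p * (psEval C η q)⁻¹, ?_⟩
  have hc : PowerSeries.constantCoeff (psEval C η q) ≠ 0 := by rwa [constantCoeff_psEval]
  have hinv := congrArg (HahnSeries.ofPowerSeries ℤ (Cbar C)) (PowerSeries.mul_inv_cancel _ hc)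
  rw [map_mul, map_one] at hinv
  rw [map_div₀, evalHom_toRat, evalHom_toRat, map_mul]
  simp only [Int.cast_zero, add_zero]
  rw [div_eq_iff (left_ne_zero_of_mul_eq_one hinv), mul_assoc, mul_comm _
    (HahnSeries.ofPowerSeries ℤ (Cbar C) (psEval C η q)), hinv, mul_one]

end LocalRing

section Valuation

lemma nuq_zero : nuq C 0 = ⊤ := by simp [nuq]

lemma nuq_ne_bot (a : LS C) : nuq C a ≠ ⊥ := by
  unfold nuq
  split_ifs
  · simp
  · exact EReal.coe_ne_bot _

lemma le_nuq_add {t : EReal} {x y : LS C} (hx : t ≤ nuq C x) (hy : t ≤ nuq C y) :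
    t ≤ nuq C (x + y) := by
  by_cases hx0 : x = 0
  · simpa [hx0] using hy
  by_cases hy0 : y = 0
  · simpa [hy0] using hx
  by_cases hxy : x + y = 0
  · simp [hxy, nuq_zero]
  have h := HahnSeries.min_order_le_order_add hxy
  simp only [nuq, hx0, hy0, hxy, if_false] at hx hy ⊢
  rcases min_le_iff.mp h with h | h
  · exact hx.trans (by exact_mod_cast h)
  · exact hy.trans (by exact_mod_cast h)

lemma le_nuq_ofPowerSeries_mul {t : EReal} (s : PowerSeries (Cbar C)) {y : LS C}
    (hy : t ≤ nuq C y) : t ≤ nuq C (HahnSeries.ofPowerSeries ℤ (Cbar C) s * y) := by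
  by_cases hy0 : y = 0
  · simp [hy0, nuq_zero]
  by_cases hs0 : HahnSeries.ofPowerSeries ℤ (Cbar C) s = 0
  · simp [hs0, nuq_zero]
  have h0 : 0 ≤ (HahnSeries.ofPowerSeries ℤ (Cbar C) s).order := by
    rw [HahnSeries.le_order_iff_forall hs0]
    intro j hj
    have := PowerSeries.coeff_coe s j
    rw [this, if_pos hj]
  have hxy := mul_ne_zero hs0 hy0
  simp only [nuq, hxy, hy0, if_false] at hy ⊢
  refine hy.trans ?_
  rw [HahnSeries.order_mul hs0 hy0]
  exact_mod_cast le_add_of_nonneg_left h0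

lemma le_nuq_sum {ι : Type*} {t : EReal} (s : Finset ι) (f : ι → LS C)
    (h : ∀ i ∈ s, t ≤ nuq C (f i)) : t ≤ nuq C (∑ i ∈ s, f i) :=
  Finset.sum_induction f (fun x => t ≤ nuq C x) (fun _ _ => le_nuq_add C)
    (by simp [nuq_zero]) h

lemma esub_nonneg_iff {x t : EReal} (hx : x ≠ ⊥) : 0 ≤ esub x t ↔ t = ⊤ ∨ t ≤ x := by
  unfold esub
  split_ifs with h
  · simp [h]
  · rw [EReal.sub_nonneg (Or.inr h) (Or.inl hx)]
    simp [h]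

lemma integralAt_iff (α : Cbar C) (f : Fin r → RatFunc C) :
    IntegralAt C ℓ r α f ↔ ∀ b ∈ SolSet C ℓ r α,
      Filter.liminf (fun n : ℕ => nuq C (b (-(n : ℤ)))) Filter.atTop = ⊤ ∨
      Filter.liminf (fun n : ℕ => nuq C (b (-(n : ℤ)))) Filter.atTop
        ≤ nuq C (elemApply C r α f b 0) := by
  simp only [IntegralAt, valAt, le_iInf_iff]
  exact forall₂_congr fun b _ => esub_nonneg_iff (nuq_ne_bot C _)

lemma elemApply_eq (α : Cbar C) (f : Fin r → RatFunc C) (b : ℤ → LS C) (n : ℤ) :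
    elemApply C r α f b n = ∑ i : Fin r, evalHom C α n (f i) * b (n + (i : ℤ)) := rfl

lemma elemApply_sum_smul {ι : Type*} [Fintype ι] (α : Cbar C) (c : ι → RatFunc C)
    (W : ι → Fin r → RatFunc C) (b : ℤ → LS C) (n : ℤ) :
    elemApply C r α (∑ i, c i • W i) b n
      = ∑ i, evalHom C α n (c i) * elemApply C r α (W i) b n := by
  simp only [elemApply_eq, Finset.sum_apply, Pi.smul_apply, smul_eq_mul, map_sum, map_mul,
    Finset.sum_mul, Finset.mul_sum, mul_assoc]
  exact Finset.sum_comm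

/-- Integrality is preserved by `C(x)_η`-linear combinations. -/
lemma IntegralAt.of_mem_localSpan {η : Cbar C} {W : Fin r → Fin r → RatFunc C}
    (hW : ∀ i, IntegralAt C ℓ r η (W i)) {f : Fin r → RatFunc C}
    (hf : f ∈ localSpan C r η W) : IntegralAt C ℓ r η f := by
  obtain ⟨c, hc, rfl⟩ := hf
  rw [integralAt_iff]
  intro b hb
  refine or_iff_not_imp_left.mpr fun htop => ?_
  rw [elemApply_sum_smul]
  refine le_nuq_sum C _ _ fun i _ => ?_
  obtain ⟨s, hs⟩ := exists_evalHom_eq_ofPowerSeries C (mem_localSubring C |>.mpr (hc i))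
  rw [hs]
  exact le_nuq_ofPowerSeries_mul C s
    (((integralAt_iff C ℓ r η (W i)).mp (hW i) b hb).resolve_left htop)

end Valuation

section Shift

lemma shift_mem_SolSet {η : Cbar C} {b : ℤ → LS C} (hb : b ∈ SolSet C ℓ r (η + 1)) :
    (fun n => b (n - 1)) ∈ SolSet C ℓ r η := by
  intro n
  have h := hb (n - 1)
  rw [← h]
  refine Finset.sum_congr rfl fun i _ => ?_
  congr 1
  · exact evalHom_congr C η (η + 1) n (n - 1) (by push_cast; ring) _
  · exact congrArg b (by ring)

lemma elemApply_Smap_shift {η : Cbar C} (hℓr : ℓ r ≠ 0) {b : ℤ → LS C}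
    (hb : b ∈ SolSet C ℓ r (η + 1)) (g : Fin r → RatFunc C) :
    elemApply C r η (Smap C ℓ r g) (fun n => b (n - 1)) 0 = elemApply C r (η + 1) g b 0 := by
  have hsol := shift_mem_SolSet C ℓ r hb 0
  obtain ⟨k, rfl⟩ : ∃ k, r = k + 1 := ⟨r - 1, by have := NeZero.ne r; omega⟩
  have hne : evalHom C η 0 (toRat C (ℓ (k + 1))) ≠ 0 := by
    rw [_root_.map_ne_zero]
    exact RatFunc.algebraMap_ne_zero hℓr
  rw [Finset.sum_range_succ, Finset.sum_range] at hsol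
  change ∑ i : Fin (k + 1), evalHom C η 0 (toRat C (ℓ i)) * b (0 + (i : ℤ) - 1)
    + evalHom C η 0 (toRat C (ℓ (k + 1))) * b (0 + ((k + 1 : ℕ) : ℤ) - 1) = 0 at hsol
  have hσ : ∀ f, evalHom C η 0 (ratσ C f) = evalHom C (η + 1) 0 f :=
    evalHom_ratσ C η (η + 1) 0 0 (by simp)
  have htail : ∑ j : Fin (k + 1),
      evalHom C η 0 (toRat C (ℓ j) / toRat C (ℓ (k + 1))) * b (0 + (j : ℤ) - 1)
        = - b (k : ℤ) := by
    simp only [map_div₀, div_mul_eq_mul_div]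
    rw [← Finset.sum_div, div_eq_iff hne, eq_neg_of_add_eq_zero_left hsol]
    have : (0 + ((k + 1 : ℕ) : ℤ) - 1) = k := by push_cast; ring
    rw [this]
    ring
  simp only [elemApply_eq, Smap, map_sub, map_mul, sub_mul, Finset.sum_sub_distrib, hσ, mul_assoc]
  rw [← Finset.mul_sum, htail, Fin.sum_univ_succ]
  conv_rhs => rw [Fin.sum_univ_castSucc]
  simp only [Fin.val_zero, if_true, map_zero, zero_mul, zero_add, Fin.val_succ,
    Nat.succ_ne_zero, if_false, hσ, Nat.add_sub_cancel, mul_neg, sub_neg_eq_add]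
  congr 1
  refine Finset.sum_congr rfl fun i _ => ?_
  congr 1
  exact congrArg b (by simp)

/-- If `S g` is integral at `η`, then `g` is integral at `η + 1`. -/
lemma IntegralAt.of_Smap {η : Cbar C} (hℓr : ℓ r ≠ 0) {g : Fin r → RatFunc C}
    (h : IntegralAt C ℓ r η (Smap C ℓ r g)) : IntegralAt C ℓ r (η + 1) g := by
  rw [integralAt_iff] at h ⊢
  intro b hb
  have h' := h _ (shift_mem_SolSet C ℓ r hb)
  rw [elemApply_Smap_shift C ℓ r hℓr hb] at h'
  have hlim : Filter.liminf (fun n : ℕ => nuq C (b (-(n : ℤ) - 1))) Filter.atTop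
      = Filter.liminf (fun n : ℕ => nuq C (b (-(n : ℤ)))) Filter.atTop := by
    rw [← Filter.liminf_nat_add (fun n : ℕ => nuq C (b (-(n : ℤ)))) 1]
    congr 1
    funext n
    congr 2
    push_cast
    ring
  rwa [hlim] at h'

lemma Smap_add (f g : Fin r → RatFunc C) :
    Smap C ℓ r (f + g) = Smap C ℓ r f + Smap C ℓ r g := by
  funext j
  simp only [Smap, Pi.add_apply, map_add]
  split_ifs <;> ring

lemma Smap_smul (c : RatFunc C) (f : Fin r → RatFunc C) :
    Smap C ℓ r (c • f) = ratσ C c • Smap C ℓ r f := by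
  funext j
  simp only [Smap, Pi.smul_apply, smul_eq_mul, map_mul]
  split_ifs <;> ring

lemma Smap_sum {ι : Type*} (s : Finset ι) (f : ι → Fin r → RatFunc C) :
    Smap C ℓ r (∑ i ∈ s, f i) = ∑ i ∈ s, Smap C ℓ r (f i) := by
  have h0 : Smap C ℓ r 0 = 0 := by
    funext j
    simp [Smap]
  exact map_sum (AddMonoidHom.mk' (Smap C ℓ r) (Smap_add C ℓ r)) f s

end Shift

/-- A nonzero polynomial has finitely many roots in `α + ℤ`. -/
lemma finite_shift_roots (α : Cbar C) {v : Polynomial C} (hv : v ≠ 0) :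
    {m : ℤ | Polynomial.aeval (α + (m : Cbar C)) v = 0}.Finite := by
  have hinj : Function.Injective fun m : ℤ => α + (m : Cbar C) := fun m n h => by
    simpa using h
  refine ((v.rootSet_finite (Cbar C)).preimage hinj.injOn).subset fun m hm => ?_
  exact (Polynomial.mem_rootSet_of_ne hv).mpr hm

lemma one_le_dispVal_of_ne {α : Cbar C} {p : Polynomial (Cbar C)} {m n : ℤ} (hmn : m ≠ n)
    (hm : p.eval (α + (m : Cbar C)) = 0) (hn : p.eval (α + (n : Cbar C)) = 0) :
    1 ≤ dispVal C α p := by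
  wlog hlt : m < n generalizing m n
  · exact this hmn.symm hn hm (by omega)
  obtain ⟨k, hk⟩ := Int.eq_ofNat_of_zero_le (sub_nonneg.mpr hlt.le)
  have hk1 : 1 ≤ k := by omega
  refine le_trans (b := (k : ℕ∞)) (by exact_mod_cast hk1)
    (le_sSup ⟨k, ⟨m, hm, ?_⟩, rfl⟩)
  obtain rfl : n = m + k := by omega
  simpa [add_assoc] using hn

theorem statement8 [NeZero r] (hr : 1 ≤ r) (hℓ : ℓ 0 * ℓ r ≠ 0)
    (W : Fin r → (Fin r → RatFunc C)) (hWb : IsVSBasis C r W) (α : Cbar C)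
    (a b : Fin r → Polynomial C) (u v : Polynomial C) (hu : u ≠ 0) (hv : v ≠ 0)
    (hgcdu : ∀ d : Polynomial C, d ∣ u → (∀ i, d ∣ a i) → IsUnit d)
    (hgcdv : ∀ d : Polynomial C, d ∣ v → (∀ i, d ∣ b i) → IsUnit d)
    (hfg : (toRat C u)⁻¹ • (∑ i, toRat C (a i) • W i)
      = Dmap C ℓ r ((toRat C v)⁻¹ • ∑ i, toRat C (b i) • W i))
    (hdisp : DispGe C α (v.map (algebraMap C (Cbar C))) 0)
    (e : Polynomial C) (M : Matrix (Fin r) (Fin r) (Polynomial C)) (he : e ≠ 0)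
    (hSW : ∀ i, Smap C ℓ r (W i) = ∑ j, (toRat C (M i j) / toRat C e) • W j)
    (mβ : ℤ)
    (hW : ∀ m : ℤ, m ≤ mβ → IsLocalIntegralBasis C ℓ r (α + (m : Cbar C)) W)
    (heroot : ∀ m : ℤ, (Polynomial.aeval (α + (m : Cbar C))) e = 0 → m = mβ) :
    1 ≤ dispVal C α
        ((X - Polynomial.C (α + (mβ : Cbar C))) * u.map (algebraMap C (Cbar C))) ∧
      ∃ m : ℤ, m ≠ mβ ∧ (Polynomial.aeval (α + (m : Cbar C))) u = 0 := by
  have hℓr : ℓ r ≠ 0 := right_ne_zero_of_mul hℓ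
  suffices hex : ∃ m : ℤ, m ≠ mβ ∧ (Polynomial.aeval (α + (m : Cbar C))) u = 0 by
    obtain ⟨m, hm, hum⟩ := hex
    refine ⟨one_le_dispVal_of_ne C (Ne.symm hm) ?_ ?_, m, hm, hum⟩
    · simp
    · rw [Polynomial.eval_mul, Polynomial.eval_map_algebraMap, hum, mul_zero]
  set c : Fin r → RatFunc C := fun i => toRat C (b i) / toRat C v with hc
  set d : Fin r → RatFunc C :=
    fun j => ∑ i, ratσ C (c i) * (toRat C (M i j) / toRat C e) with hd
  have hg : (toRat C v)⁻¹ • ∑ i, toRat C (b i) • W i = ∑ i, c i • W i := by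
    rw [Finset.smul_sum]
    exact Finset.sum_congr rfl fun i _ => by rw [smul_smul, ← div_eq_inv_mul]
  have hf : (toRat C u)⁻¹ • ∑ i, toRat C (a i) • W i
      = ∑ i, (toRat C (a i) / toRat C u) • W i := by
    rw [Finset.smul_sum]
    exact Finset.sum_congr rfl fun i _ => by rw [smul_smul, ← div_eq_inv_mul]
  have hSg : Smap C ℓ r (∑ i, c i • W i) = ∑ j, d j • W j := by
    rw [Smap_sum]
    simp only [Smap_smul, hSW, Finset.smul_sum, smul_smul, hd, Finset.sum_smul]
    exact Finset.sum_comm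
  rw [hf, hg, Dmap, hSg, ← Finset.sum_sub_distrib] at hfg
  simp only [← sub_smul] at hfg
  have hcoef : ∀ j, toRat C (a j) / toRat C u = d j - c j := fun j =>
    congrFun (hWb.1.fintypeLinearCombination_injective
      (by simpa [Fintype.linearCombination_apply] using hfg)) j
  have hfin := finite_shift_roots C α hv
  have hne : {m : ℤ | Polynomial.aeval (α + (m : Cbar C)) v = 0}.Nonempty := by
    obtain ⟨m, hm, -⟩ := hdisp
    exact ⟨m, by rwa [Polynomial.eval_map_algebraMap] at hm⟩
  obtain ⟨m₁, hm₁, hmax⟩ := Set.exists_max_image _ id hfin hne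
  obtain ⟨m₀, hm₀, hmin⟩ := Set.exists_min_image _ id hfin hne
  simp only [Set.mem_ofPred_eq, id] at hm₁ hmax hm₀ hmin
  by_cases hβ : m₁ = mβ
  · refine ⟨m₀ - 1, by have := hmin m₁ hm₁; omega, ?_⟩
    by_contra hu0
    have hle : m₀ ≤ mβ := hβ ▸ hmin m₁ hm₁
    have hv0 : Polynomial.aeval (α + ((m₀ - 1 : ℤ) : Cbar C)) v ≠ 0 := fun h => by
      have := hmin _ h
      omega
    have hηs : α + ((m₀ - 1 : ℤ) : Cbar C) + 1 = α + (m₀ : Cbar C) := by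
      push_cast
      ring
    have hloc : ∑ j, d j • W j ∈ localSpan C r (α + ((m₀ - 1 : ℤ) : Cbar C)) W := by
      refine ⟨d, fun j => ?_, rfl⟩
      rw [← mem_localSubring, eq_add_of_sub_eq (hcoef j).symm]
      exact add_mem (div_mem_localSubring C _ hu0) (div_mem_localSubring C _ hv0)
    rw [← hSg] at hloc
    have hint := IntegralAt.of_Smap C ℓ r hℓr
      (IntegralAt.of_mem_localSpan C ℓ r (hW (m₀ - 1) (by omega)).2.1 hloc)
    rw [hηs] at hint
    obtain ⟨c', hc', hcc'⟩ := (hW m₀ hle).2.2 _ hint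
    have hcoef' : c = c' := hWb.1.fintypeLinearCombination_injective
      (by simpa [Fintype.linearCombination_apply] using hcc')
    obtain ⟨i, hi⟩ := exists_div_notMem_localSubring C hv hgcdv hm₀
    have hi' := hc' i
    rw [← hcoef'] at hi'
    exact hi hi'
  · refine ⟨m₁, hβ, ?_⟩
    by_contra hu0
    have hv1 : Polynomial.aeval (α + (m₁ : Cbar C) + 1) v ≠ 0 := fun h => by
      have := hmax (m₁ + 1) (by rw [← h]; push_cast; rw [add_assoc])
      omega
    have he1 : Polynomial.aeval (α + (m₁ : Cbar C)) e ≠ 0 := fun h => hβ (heroot _ h)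
    obtain ⟨j, hj⟩ := exists_div_notMem_localSubring C hv hgcdv hm₁
    refine hj ?_
    have hcj : toRat C (b j) / toRat C v = d j - toRat C (a j) / toRat C u := by
      rw [hcoef j, sub_sub_cancel]
    rw [hcj]
    refine sub_mem (sum_mem fun i _ => mul_mem ?_ (div_mem_localSubring C _ he1))
      (div_mem_localSubring C _ hu0)
    exact ratσ_mem_localSubring C (div_mem_localSubring C _ hv1)

end PRec
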